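/- arXiv:1302.1958 — 2 statements merged into one kernel-verified Lean document; each statement's English description precedes it below -/
import Mathlib

section
/- Let a, b be bounded operators on a complex Hilbert space H satisfying D_ξ(b) ≤ D_ξ(a) for all unit vectors ξ. If α, β belong to the approximate point spectrum of a, with sequences of unit vectors (ξ_n), (η_n) such that ‖(a − α)ξ_n‖ → 0 and ‖(a − β)η_n‖ → 0, then the sequences λ_n = ⟨bξ_n, ξ_n⟩ and μ_n = ⟨bη_n, η_n⟩ converge, their limits λ and μ lie in the approximate point spectrum of b, and |μ − λ| ≤ |β − α|. -/
open scoped InnerProductSpace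
open Filter Topology

section Variance

variable {H : Type*} [NormedAddCommGroup H] [InnerProductSpace ℂ H]

/-- The square root of the Gram determinant of `z` and `x`: the norm of `z` times the distance
from `x` to the line spanned by `z`. -/
noncomputable def gramRoot (z x : H) : ℝ := ‖z‖ * ‖(ℂ ∙ z)ᗮ.starProjection x‖

lemma gramRoot_nonneg (z x : H) : 0 ≤ gramRoot z x := by
  unfold gramRoot; positivity

lemma gramRoot_sq (z x : H) : gramRoot z x ^ 2 = ‖z‖ ^ 2 * ‖x‖ ^ 2 - ‖⟪z, x⟫_ℂ‖ ^ 2 := by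
  rcases eq_or_ne z 0 with rfl | hz
  · simp [gramRoot]
  have hz' : ‖z‖ ≠ 0 := norm_ne_zero_iff.mpr hz
  have key := Submodule.norm_sq_eq_add_norm_sq_starProjection x (ℂ ∙ z)
  rw [Submodule.starProjection_singleton, norm_smul, norm_div] at key
  simp only [Complex.coe_algebraMap, Complex.norm_real, norm_pow, norm_norm] at key
  rw [gramRoot, mul_pow, key]
  field_simp
  ring

lemma gramRoot_add_le (z x y : H) : gramRoot z (x + y) ≤ gramRoot z x + gramRoot z y := by
  unfold gramRoot
  rw [map_add, ← mul_add]
  gcongr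
  exact norm_add_le _ _

lemma gramRoot_smul (z x : H) (c : ℂ) : gramRoot z (c • x) = ‖c‖ * gramRoot z x := by
  unfold gramRoot
  rw [map_smul, norm_smul]
  ring

lemma gramRoot_add_smul_self (z x : H) (c : ℂ) : gramRoot z (x + c • z) = gramRoot z x := by
  have hz : (ℂ ∙ z)ᗮ.starProjection z = 0 := by
    rw [Submodule.starProjection_apply_eq_zero_iff]
    exact Submodule.le_orthogonal_orthogonal _ (Submodule.mem_span_singleton_self z)
  rw [gramRoot, gramRoot, map_add, map_smul, hz, smul_zero, add_zero]

lemma gramRoot_comm (z x : H) : gramRoot z x = gramRoot x z := by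
  rw [← sq_eq_sq₀ (gramRoot_nonneg _ _) (gramRoot_nonneg _ _), gramRoot_sq, gramRoot_sq,
    norm_inner_symm, mul_comm]

lemma gramRoot_le (z x : H) : gramRoot z x ≤ ‖z‖ * ‖x‖ := by
  unfold gramRoot
  gcongr
  exact Submodule.norm_starProjection_apply_le _ _

/-- The norm of the component of `x` orthogonal to a unit vector `z`. -/
lemma norm_sub_inner_smul (z x : H) (hz : ‖z‖ = 1) :
    ‖x - ⟪z, x⟫_ℂ • z‖ = gramRoot z x := by
  have e : ‖x - ⟪z, x⟫_ℂ • z‖ = ‖(ℂ ∙ z)ᗮ.starProjection x‖ := by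
    rw [Submodule.starProjection_orthogonal_val, Submodule.starProjection_unit_singleton ℂ hz]
  rw [gramRoot, hz, one_mul, e]

/-- The variance inequality, in homogeneous form. -/
lemma gramRoot_apply_le {a b : H →L[ℂ] H}
    (h : ∀ ξ : H, ‖ξ‖ = 1 →
      ‖b ξ‖ ^ 2 - ‖(⟪b ξ, ξ⟫_ℂ)‖ ^ 2 ≤ ‖a ξ‖ ^ 2 - ‖(⟪a ξ, ξ⟫_ℂ)‖ ^ 2) (z : H) :
    gramRoot z (b z) ≤ gramRoot z (a z) := by
  rcases eq_or_ne z 0 with rfl | hz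
  · simp [gramRoot]
  have hz' : 0 < ‖z‖ := norm_pos_iff.mpr hz
  have hn : ‖((‖z‖⁻¹ : ℝ) : ℂ)‖ = ‖z‖⁻¹ := by simp
  have h1 := h (((‖z‖⁻¹ : ℝ) : ℂ) • z) (by rw [norm_smul, hn]; field_simp)
  simp only [map_smul, inner_smul_left, inner_smul_right, norm_mul, norm_smul,
    RCLike.norm_conj, hn] at h1
  rw [← sq_le_sq₀ (gramRoot_nonneg _ _) (gramRoot_nonneg _ _), gramRoot_sq, gramRoot_sq,
    norm_inner_symm z, norm_inner_symm z]
  have h2 := mul_le_mul_of_nonneg_left h1 (by positivity : 0 ≤ ‖z‖ ^ 4)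
  field_simp at h2
  linarith

/-- An approximate eigenvector of `a` is at least as good an approximate eigenvector of `b`. -/
lemma norm_apply_sub_inner_smul_le {a b : H →L[ℂ] H}
    (h : ∀ ξ : H, ‖ξ‖ = 1 →
      ‖b ξ‖ ^ 2 - ‖(⟪b ξ, ξ⟫_ℂ)‖ ^ 2 ≤ ‖a ξ‖ ^ 2 - ‖(⟪a ξ, ξ⟫_ℂ)‖ ^ 2)
    (α : ℂ) (x : H) (hx : ‖x‖ = 1) :
    ‖b x - ⟪x, b x⟫_ℂ • x‖ ≤ ‖a x - α • x‖ := by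
  rw [norm_sub_inner_smul _ _ hx]
  refine (gramRoot_apply_le h x).trans ?_
  rw [← gramRoot_add_smul_self x (a x) (-α), neg_smul, ← sub_eq_add_neg]
  simpa [hx] using gramRoot_le x (a x - α • x)

lemma norm_inner_apply_le (b : H →L[ℂ] H) (x : H) (hx : ‖x‖ = 1) : ‖⟪x, b x⟫_ℂ‖ ≤ ‖b‖ := by
  have h1 := norm_inner_le_norm (𝕜 := ℂ) x (b x)
  have h2 := b.le_opNorm x
  rw [hx] at h1 h2
  linarith

/-- The quadratic form of `b` is nearly nonexpansive in the approximate eigenvalues of `a`. -/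
lemma norm_inner_apply_sub_le {a b : H →L[ℂ] H}
    (h : ∀ ξ : H, ‖ξ‖ = 1 →
      ‖b ξ‖ ^ 2 - ‖(⟪b ξ, ξ⟫_ℂ)‖ ^ 2 ≤ ‖a ξ‖ ^ 2 - ‖(⟪a ξ, ξ⟫_ℂ)‖ ^ 2)
    (α β : ℂ) (x y : H) (hx : ‖x‖ = 1) (hy : ‖y‖ = 1) :
    ‖⟪y, b y⟫_ℂ - ⟪x, b x⟫_ℂ‖ ≤
      ‖β - α‖ + √(10 * ‖b‖ * (‖a x - α • x‖ + ‖a y - β • y‖)) := by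
  set lam := ⟪x, b x⟫_ℂ with hlam
  set mu := ⟪y, b y⟫_ℂ with hmu
  set p := ‖a x - α • x‖ + ‖a y - β • y‖ with hp
  have hp0 : 0 ≤ p := by positivity
  have hu := norm_apply_sub_inner_smul_le h α x hx
  have hv := norm_apply_sub_inner_smul_le h β y hy
  rw [← hlam] at hu
  rw [← hmu] at hv
  have hlb : ‖lam‖ ≤ ‖b‖ := norm_inner_apply_le b x hx
  have hmb : ‖mu‖ ≤ ‖b‖ := norm_inner_apply_le b y hy
  have hδ : ‖mu - lam‖ ≤ 2 * ‖b‖ := (norm_sub_le _ _).trans (by linarith)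
  have hz : ‖x + y‖ ≤ 2 := (norm_add_le _ _).trans (by linarith)
  have hg : gramRoot (x + y) y = gramRoot x y := by
    rw [gramRoot_comm, gramRoot_comm x, ← gramRoot_add_smul_self y x 1, one_smul]
  have hg0 := gramRoot_nonneg x y
  have hsmall : ∀ w : H, ‖w‖ ≤ p → gramRoot (x + y) w ≤ 2 * p := fun w hw =>
    (gramRoot_le _ _).trans (mul_le_mul hz hw (norm_nonneg _) (by norm_num))
  -- The variance inequality at `x + y`.
  have hvar : ‖mu - lam‖ * gramRoot x y ≤ ‖β - α‖ * gramRoot x y + 4 * p := by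
    have e1 : (mu - lam) • y =
        (b (x + y) + (-lam) • (x + y)) + -((b x - lam • x) + (b y - mu • y)) := by
      rw [map_add]; module
    have e2 : a (x + y) + (-α) • (x + y) =
        (β - α) • y + ((a x - α • x) + (a y - β • y)) := by
      rw [map_add]; module
    have h1 := gramRoot_add_le (x + y) (b (x + y) + (-lam) • (x + y))
      (-((b x - lam • x) + (b y - mu • y)))
    rw [← e1, gramRoot_add_smul_self, gramRoot_smul, hg] at h1
    have h2 := gramRoot_add_le (x + y) ((β - α) • y) ((a x - α • x) + (a y - β • y))
    rw [← e2, gramRoot_add_smul_self, gramRoot_smul, hg] at h2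
    have h3 := gramRoot_apply_le h (x + y)
    have h4 := hsmall _ ((norm_neg _).trans_le
      ((norm_add_le (b x - lam • x) (b y - mu • y)).trans (add_le_add hu hv)))
    have h5 := hsmall _ (norm_add_le (a x - α • x) (a y - β • y))
    linarith
  -- Nearly parallel approximate eigenvectors have nearly equal approximate eigenvalues.
  have hpar : ‖mu - lam‖ ≤ 2 * ‖b‖ * gramRoot x y + p := by
    set c := ⟪x, y⟫_ℂ with hc
    have hc1 : ‖c‖ ≤ 1 := by simpa [hx, hy] using norm_inner_le_norm (𝕜 := ℂ) x y
    have hw : ‖y - c • x‖ = gramRoot x y := norm_sub_inner_smul x y hx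
    have e : (mu - lam) • y = (b (y - c • x) - lam • (y - c • x)) +
        (c • (b x - lam • x) - (b y - mu • y)) := by
      rw [map_sub, map_smul]; module
    have h1 : ‖(mu - lam) • y‖ = ‖mu - lam‖ := by rw [norm_smul, hy, mul_one]
    rw [← h1, e]
    refine (norm_add_le _ _).trans (add_le_add ?_ ?_)
    · refine (norm_sub_le _ _).trans ?_
      have h2 := b.le_opNorm (y - c • x)
      rw [norm_smul]
      rw [hw] at h2 ⊢
      nlinarith
    · refine (norm_sub_le _ _).trans (add_le_add ?_ hv)
      rw [norm_smul]
      exact (mul_le_of_le_one_left (norm_nonneg _) hc1).trans hu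
  rw [← sub_le_iff_le_add']
  rcases le_total (‖mu - lam‖ - ‖β - α‖) 0 with hneg | hpos
  · exact hneg.trans (Real.sqrt_nonneg _)
  apply Real.le_sqrt_of_sq_le
  have hγ := norm_nonneg (β - α)
  have hb := norm_nonneg b
  calc (‖mu - lam‖ - ‖β - α‖) ^ 2
      ≤ (‖mu - lam‖ - ‖β - α‖) * (2 * ‖b‖ * gramRoot x y + p) := by
        rw [sq]; gcongr; linarith
    _ = 2 * ‖b‖ * (‖mu - lam‖ * gramRoot x y - ‖β - α‖ * gramRoot x y)
        + (‖mu - lam‖ - ‖β - α‖) * p := by ring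
    _ ≤ 2 * ‖b‖ * (4 * p) + 2 * ‖b‖ * p := by gcongr <;> linarith
    _ = 10 * ‖b‖ * p := by ring

/-- Along an approximate eigenvector sequence of `a`, the quadratic form of `b` converges, and
the sequence is an approximate eigenvector sequence of `b` for the limit. -/
lemma exists_tendsto_inner_apply {a b : H →L[ℂ] H}
    (h : ∀ ξ : H, ‖ξ‖ = 1 →
      ‖b ξ‖ ^ 2 - ‖(⟪b ξ, ξ⟫_ℂ)‖ ^ 2 ≤ ‖a ξ‖ ^ 2 - ‖(⟪a ξ, ξ⟫_ℂ)‖ ^ 2)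
    {α : ℂ} {ξ : ℕ → H} (hξ : ∀ n, ‖ξ n‖ = 1)
    (hξa : Tendsto (fun n => ‖a (ξ n) - α • ξ n‖) atTop (𝓝 0)) :
    ∃ lam : ℂ, Tendsto (fun n => ⟪ξ n, b (ξ n)⟫_ℂ) atTop (𝓝 lam) ∧
      Tendsto (fun n => ‖b (ξ n) - lam • ξ n‖) atTop (𝓝 0) := by
  have hcauchy : CauchySeq fun n => ⟪ξ n, b (ξ n)⟫_ℂ := by
    rw [cauchySeq_iff_tendsto_dist_atTop_0]
    have hlim : Tendsto (fun n : ℕ × ℕ => √(10 * ‖b‖ *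
        (‖a (ξ n.2) - α • ξ n.2‖ + ‖a (ξ n.1) - α • ξ n.1‖))) atTop (𝓝 0) := by
      rw [← prod_atTop_atTop_eq]
      simpa using (((hξa.comp tendsto_snd).add (hξa.comp tendsto_fst)).const_mul
        (10 * ‖b‖)).sqrt
    refine squeeze_zero (fun _ => dist_nonneg) (fun n => ?_) hlim
    rw [dist_eq_norm]
    simpa using norm_inner_apply_sub_le h α α (ξ n.2) (ξ n.1) (hξ _) (hξ _)
  obtain ⟨lam, hlam⟩ := cauchySeq_tendsto_of_complete hcauchy
  refine ⟨lam, hlam, ?_⟩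
  have hlim := hξa.add (tendsto_iff_norm_sub_tendsto_zero.mp hlam)
  rw [add_zero] at hlim
  refine squeeze_zero (fun _ => norm_nonneg _) (fun n => ?_) hlim
  have e : b (ξ n) - lam • ξ n =
      (b (ξ n) - ⟪ξ n, b (ξ n)⟫_ℂ • ξ n) + (⟪ξ n, b (ξ n)⟫_ℂ - lam) • ξ n := by module
  rw [e]
  refine (norm_add_le _ _).trans (add_le_add (norm_apply_sub_inner_smul_le h α _ (hξ n)) ?_)
  rw [norm_smul, hξ n, mul_one]

end Variance

/-- If `D_ξ(b) ≤ D_ξ(a)` for all unit vectors and `α, β` are approximate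
eigenvalues of `a` with witnessing unit-vector sequences, then
`λ_n = ⟨bξ_n, ξ_n⟩` and `μ_n = ⟨bη_n, η_n⟩` converge, their limits lie in the
approximate point spectrum of `b`, and `|μ − λ| ≤ |β − α|`. -/
theorem stmt_7 {H : Type*} [NormedAddCommGroup H] [InnerProductSpace ℂ H]
    (a b : H →L[ℂ] H)
    (h : ∀ ξ : H, ‖ξ‖ = 1 →
      ‖b ξ‖ ^ 2 - ‖(⟪b ξ, ξ⟫_ℂ)‖ ^ 2 ≤ ‖a ξ‖ ^ 2 - ‖(⟪a ξ, ξ⟫_ℂ)‖ ^ 2)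
    (α β : ℂ) (ξ η : ℕ → H)
    (hξ1 : ∀ n, ‖ξ n‖ = 1) (hη1 : ∀ n, ‖η n‖ = 1)
    (hξa : Tendsto (fun n => ‖a (ξ n) - α • ξ n‖) atTop (𝓝 0))
    (hηa : Tendsto (fun n => ‖a (η n) - β • η n‖) atTop (𝓝 0)) :
    ∃ lam mu : ℂ,
      Tendsto (fun n => (⟪ξ n, b (ξ n)⟫_ℂ)) atTop (𝓝 lam) ∧
      Tendsto (fun n => (⟪η n, b (η n)⟫_ℂ)) atTop (𝓝 mu) ∧
      (∃ ζ : ℕ → H, (∀ n, ‖ζ n‖ = 1) ∧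
        Tendsto (fun n => ‖b (ζ n) - lam • ζ n‖) atTop (𝓝 0)) ∧
      (∃ ζ : ℕ → H, (∀ n, ‖ζ n‖ = 1) ∧
        Tendsto (fun n => ‖b (ζ n) - mu • ζ n‖) atTop (𝓝 0)) ∧
      ‖mu - lam‖ ≤ ‖β - α‖ := by
  obtain ⟨lam, hlam, hlamb⟩ := exists_tendsto_inner_apply h hξ1 hξa
  obtain ⟨mu, hmu, hmub⟩ := exists_tendsto_inner_apply h hη1 hηa
  refine ⟨lam, mu, hlam, hmu, ⟨ξ, hξ1, hlamb⟩, ⟨η, hη1, hmub⟩, ?_⟩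
  have hlim : Tendsto (fun n => ‖β - α‖ + √(10 * ‖b‖ *
      (‖a (ξ n) - α • ξ n‖ + ‖a (η n) - β • η n‖))) atTop (𝓝 ‖β - α‖) := by
    simpa using (((hξa.add hηa).const_mul (10 * ‖b‖)).sqrt).const_add ‖β - α‖
  exact le_of_tendsto_of_tendsto' (hmu.sub hlam).norm hlim
    fun n => norm_inner_apply_sub_le h α β (ξ n) (η n) (hξ1 n) (hη1 n)
end

section
/- Let a ∈ B(H) be subnormal with minimal normal extension c ∈ B(K), K ⊇ H, and let g : ℂ → ℂ be a compactly supported differentiable function such that ∂̄g is bounded and vanishes on σ(a). Then for all ξ, η ∈ H: ⟨g(a)η, ξ⟩ = −(1/π) ∫_{ℂ∖σ(a)} ∂̄g(ζ) ⟨(ζ·1 − a)⁻¹η, ξ⟩ dm(ζ), where m is planar Lebesgue measure; in particular the integral is absolutely convergent. -/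
open scoped InnerProductSpace
open MeasureTheory

lemma dbar_eq_zero_of_notMem_tsupport {g dbar : ℂ → ℂ}
    (hdbar : ∀ ζ, dbar ζ = (1 / 2) * (fderiv ℝ g ζ 1 + Complex.I * fderiv ℝ g ζ Complex.I))
    {ζ : ℂ} (hζ : ζ ∉ tsupport g) : dbar ζ = 0 := by
  have h : fderiv ℝ g ζ = 0 := by
    by_contra hne
    exact hζ (support_fderiv_subset ℝ (f := g) hne)
  simp [hdbar, h]

/-- The polar form of `∂̄`: `∂_r + i r⁻¹ ∂_θ = 2 e^{-iθ} ∂̄`, at the level of differentials. -/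
lemma map_exp_add_I_mul_map (L : ℂ →L[ℝ] ℂ) (θ : ℝ) :
    L (Complex.exp (θ * Complex.I)) + Complex.I * L (Complex.I * Complex.exp (θ * Complex.I)) =
      (L 1 + Complex.I * L Complex.I) * Complex.exp (-(θ * Complex.I)) := by
  have h1 : Complex.exp (θ * Complex.I) = Real.cos θ • (1 : ℂ) + Real.sin θ • Complex.I := by
    rw [Complex.exp_mul_I]; simp
  have h2 : Complex.I * Complex.exp (θ * Complex.I) =
      (-Real.sin θ) • (1 : ℂ) + Real.cos θ • Complex.I := by
    rw [Complex.exp_mul_I]; simp only [Complex.real_smul]; push_cast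
    linear_combination Complex.sin θ * Complex.I_sq
  have h3 : Complex.exp (-(θ * Complex.I)) = Real.cos θ - Real.sin θ * Complex.I := by
    rw [← neg_mul, Complex.exp_mul_I]; simp [sub_eq_add_neg]
  rw [h2, h1, h3]
  simp only [map_add, L.map_smul]
  simp only [Complex.real_smul]
  push_cast
  linear_combination (L Complex.I) * Complex.sin θ * Complex.I_sq

open Complex in
/-- Divergence theorem in polar coordinates on an annulus containing the support. -/
lemma intervalIntegral_dbar_polar {g dbar : ℂ → ℂ} (hg : Differentiable ℝ g)
    (hdbar : ∀ ζ, dbar ζ = (1 / 2) * (fderiv ℝ g ζ 1 + I * fderiv ℝ g ζ I))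
    {M : ℝ} (hM : ∀ ζ, ‖dbar ζ‖ ≤ M) (hmeas : Measurable dbar) (z : ℂ) {R : ℝ}
    (hR : ∀ θ : ℝ, g (z + R * exp (θ * I)) = 0) {ε : ℝ} (hε : 0 < ε) (hεR : ε ≤ R) :
    ∫ r in ε..R, ∫ θ in (-Real.pi)..Real.pi, 2 * (dbar (z + r * exp (θ * I)) * exp (-(θ * I))) =
      -∫ θ in (-Real.pi)..Real.pi, g (z + ε * exp (θ * I)) := by
  set p : ℝ × ℝ → ℂ := fun x => g (z + x.1 * exp (x.2 * I)) with hp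
  set q : ℝ × ℝ → ℂ := fun x => (I * (x.1 : ℂ)⁻¹) * p x with hq
  have hpd : Differentiable ℝ p := by
    refine hg.comp ?_
    have : Differentiable ℝ (fun x : ℝ => (x : ℂ)) := Complex.ofRealCLM.differentiable
    fun_prop
  have hqd : ∀ x : ℝ × ℝ, 0 < x.1 → DifferentiableAt ℝ q x := by
    intro x hx
    have h1 : DifferentiableAt ℝ (fun x : ℝ × ℝ => (x.1 : ℂ)) x :=
      (Complex.ofRealCLM.differentiable.comp differentiable_fst) x
    have hx0 : (x.1 : ℂ) ≠ 0 := by exact_mod_cast hx.ne'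
    exact ((h1.inv hx0).const_mul I).mul (hpd x)
  have key : ∀ x : ℝ × ℝ, 0 < x.1 → fderiv ℝ p x (1, 0) + fderiv ℝ q x (0, 1) =
      2 * (dbar (z + x.1 * exp (x.2 * I)) * exp (-(x.2 * I))) := by
    rintro ⟨r, θ⟩ hr
    have hr : 0 < r := hr
    have hr0 : (r : ℂ) ≠ 0 := by exact_mod_cast hr.ne'
    set L := fderiv ℝ g (z + r * exp (θ * I)) with hL
    have e1 : fderiv ℝ p (r, θ) (1, 0) = L (exp (θ * I)) := by
      have a1 : HasDerivAt (fun t : ℝ => ((t, θ) : ℝ × ℝ)) (1, 0) r :=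
        (hasDerivAt_id r).prodMk (hasDerivAt_const r θ)
      have a2 := (hpd (r, θ)).hasFDerivAt.comp_hasDerivAt r a1
      have a3 : HasDerivAt (fun t : ℝ => z + t * exp (θ * I)) (exp (θ * I)) r := by
        simpa using ((hasDerivAt_id r).ofReal_comp.mul_const (exp (θ * I))).const_add z
      have a4 := (hg (z + r * exp (θ * I))).hasFDerivAt.comp_hasDerivAt r a3
      exact a2.unique a4
    have e2 : fderiv ℝ q (r, θ) (0, 1) = I * L (I * exp (θ * I)) := by
      have a1 : HasDerivAt (fun t : ℝ => ((r, t) : ℝ × ℝ)) (0, 1) θ :=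
        (hasDerivAt_const θ r).prodMk (hasDerivAt_id θ)
      have a2 := (hqd (r, θ) hr).hasFDerivAt.comp_hasDerivAt θ a1
      have a3 : HasDerivAt (fun t : ℝ => z + r * exp (t * I)) (r • (I * exp (θ * I))) θ := by
        have b1 : HasDerivAt (fun t : ℝ => (t : ℂ) * I) I θ := by
          simpa using (hasDerivAt_id θ).ofReal_comp.mul_const I
        have := (b1.cexp.const_mul (r : ℂ)).const_add z
        rwa [← mul_comm I] at this
      have a4 := ((hg (z + r * exp (θ * I))).hasFDerivAt.comp_hasDerivAt θ a3).const_mul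
        (I * (r : ℂ)⁻¹)
      have a5 := a2.unique a4
      rw [a5, map_smul, Complex.real_smul, mul_assoc, ← mul_assoc _ (r : ℂ), inv_mul_cancel₀ hr0,
        one_mul]
    rw [e1, e2, map_exp_add_I_mul_map, hdbar]
    ring
  have hsub : ∀ x ∈ (Set.uIcc ε R ×ˢ Set.uIcc (-Real.pi) Real.pi), 0 < x.1 := by
    rintro x ⟨h1, -⟩
    rw [Set.uIcc_of_le hεR] at h1
    exact hε.trans_le h1.1
  have hDm : Measurable fun x : ℝ × ℝ =>
      2 * (dbar (z + x.1 * exp (x.2 * I)) * exp (-(x.2 * I))) := by fun_prop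
  have hDint : IntegrableOn (fun x : ℝ × ℝ =>
      2 * (dbar (z + x.1 * exp (x.2 * I)) * exp (-(x.2 * I))))
      (Set.uIcc ε R ×ˢ Set.uIcc (-Real.pi) Real.pi) := by
    refine Measure.integrableOn_of_bounded (M := 2 * M)
      (isCompact_uIcc.prod isCompact_uIcc).measure_lt_top.ne hDm.aestronglyMeasurable ?_
    refine Filter.Eventually.of_forall fun x => ?_
    have : ‖exp (-(x.2 * I))‖ = 1 := by
      rw [← neg_mul, ← ofReal_neg]; exact norm_exp_ofReal_mul_I _
    simp [this, hM]
  have hdiv := integral2_divergence_prod_of_hasFDerivAt_off_countable p q (fderiv ℝ p) (fderiv ℝ q)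
    ε (-Real.pi) R Real.pi ∅ Set.countable_empty hpd.continuous.continuousOn
    (fun x hx => (hqd x (hsub x hx)).continuousAt.continuousWithinAt)
    (fun x _ => (hpd x).hasFDerivAt) (fun x hx => (hqd x (by
      have := hx.1.1.1
      rw [min_eq_left hεR] at this
      exact hε.trans this)).hasFDerivAt)
    (hDint.congr_fun (fun x hx => (key x (hsub x hx)).symm)
      (measurableSet_uIcc.prod measurableSet_uIcc))
  have hl : ∫ r in ε..R, ∫ θ in (-Real.pi)..Real.pi,
      2 * (dbar (z + r * exp (θ * I)) * exp (-(θ * I))) =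
      ∫ r in ε..R, ∫ θ in (-Real.pi)..Real.pi,
        fderiv ℝ p (r, θ) (1, 0) + fderiv ℝ q (r, θ) (0, 1) := by
    refine intervalIntegral.integral_congr fun r hr => ?_
    rw [Set.uIcc_of_le hεR] at hr
    simp only [key (r, _) (hε.trans_le hr.1)]
  have hper : ∀ r : ℝ, q (r, Real.pi) = q (r, -Real.pi) := by
    intro r
    have h : exp (((-Real.pi : ℝ) : ℂ) * I) = exp ((Real.pi : ℂ) * I) := by
      rw [ofReal_neg, neg_mul, exp_neg, exp_pi_mul_I]; norm_num
    simp only [hq, hp, h]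
  rw [hl, hdiv]
  simp only [hper, sub_self, zero_add]
  simp only [hp, hR]
  simp

open Complex in
/-- Cauchy–Pompeiu formula for a compactly supported, everywhere real-differentiable function with
bounded `∂̄`-derivative. -/
lemma integral_dbar_mul_inv_sub {g dbar : ℂ → ℂ} (hg : Differentiable ℝ g)
    (hgc : HasCompactSupport g)
    (hdbar : ∀ ζ, dbar ζ = (1 / 2) * (fderiv ℝ g ζ 1 + I * fderiv ℝ g ζ I))
    {M : ℝ} (hM : ∀ ζ, ‖dbar ζ‖ ≤ M) (hmeas : Measurable dbar) (z : ℂ) :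
    ∫ ζ, dbar ζ * (ζ - z)⁻¹ = -(Real.pi : ℂ) * g z := by
  obtain ⟨R, hR0, hR⟩ : ∃ R : ℝ, 0 < R ∧ ∀ w : ℂ, R ≤ ‖w‖ → z + w ∉ tsupport g := by
    obtain ⟨R, hR⟩ := hgc.isBounded.subset_closedBall z
    refine ⟨max R 0 + 1, by positivity, fun w hw hmem => ?_⟩
    have := hR hmem
    simp only [Metric.mem_closedBall, dist_eq_norm, add_sub_cancel_left] at this
    linarith [le_max_left R 0]
  have hnorm : ∀ r θ : ℝ, 0 ≤ r → ‖(r : ℂ) * exp (θ * I)‖ = r := by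
    intro r θ hr
    simp [norm_exp_ofReal_mul_I, abs_of_nonneg hr]
  have hd0 : ∀ r θ : ℝ, R ≤ r → dbar (z + r * exp (θ * I)) = 0 := by
    intro r θ hr
    have h := hR (r * exp (θ * I)) (by rwa [hnorm _ _ (hR0.le.trans hr)])
    exact dbar_eq_zero_of_notMem_tsupport hdbar h
  set D : ℝ → ℝ → ℂ := fun r θ => 2 * (dbar (z + r * exp (θ * I)) * exp (-(θ * I))) with hD
  have hDm : Measurable (Function.uncurry D) := by
    simp only [hD, Function.uncurry_def]; fun_prop
  have hDb : ∀ r θ, ‖D r θ‖ ≤ 2 * M := by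
    intro r θ
    have : ‖exp (-(θ * I))‖ = 1 := by
      rw [← neg_mul, ← ofReal_neg]; exact norm_exp_ofReal_mul_I _
    simp [hD, this, hM]
  have hpol : ∫ r in (0 : ℝ)..R, ∫ θ in (-Real.pi)..Real.pi, D r θ = -(2 * Real.pi * g z) := by
    have hI : ∀ a b : ℝ, IntervalIntegrable (fun r => ∫ θ in (-Real.pi)..Real.pi, D r θ)
        volume a b := by
      intro a b
      rw [intervalIntegrable_iff]
      have hm : StronglyMeasurable fun r => ∫ θ in (-Real.pi)..Real.pi, D r θ := by
        simp only [intervalIntegral.integral_of_le (neg_le_self Real.pi_pos.le)]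
        exact hDm.stronglyMeasurable.integral_prod_right
      refine Measure.integrableOn_of_bounded (M := 2 * M * |Real.pi - -Real.pi|)
        (by simp [Set.uIoc]) hm.aestronglyMeasurable (Filter.Eventually.of_forall fun r => ?_)
      exact intervalIntegral.norm_integral_le_of_norm_le_const fun θ _ => hDb r θ
    have hc1 : Continuous fun ε : ℝ => ∫ r in ε..R, ∫ θ in (-Real.pi)..Real.pi, D r θ := by
      simp_rw [fun ε : ℝ => intervalIntegral.integral_symm (μ := volume)
        (f := fun r => ∫ θ in (-Real.pi)..Real.pi, D r θ) R ε]
      exact (intervalIntegral.continuous_primitive hI R).neg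
    have hc2 : Continuous fun ε : ℝ =>
        -∫ θ in (-Real.pi)..Real.pi, g (z + ε * exp (θ * I)) := by
      refine (intervalIntegral.continuous_parametric_intervalIntegral_of_continuous' ?_ _ _).neg
      have := hg.continuous
      fun_prop
    have h1 := (hc1.tendsto 0).mono_left (nhdsWithin_le_nhds (s := Set.Ioi 0))
    have h2 := (hc2.tendsto 0).mono_left (nhdsWithin_le_nhds (s := Set.Ioi 0))
    have heq : (fun ε : ℝ => ∫ r in ε..R, ∫ θ in (-Real.pi)..Real.pi, D r θ)
        =ᶠ[nhdsWithin 0 (Set.Ioi 0)]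
        (fun ε : ℝ => -∫ θ in (-Real.pi)..Real.pi, g (z + ε * exp (θ * I))) := by
      filter_upwards [Ioo_mem_nhdsGT hR0] with ε hε
      refine intervalIntegral_dbar_polar hg hdbar hM hmeas z (fun θ => ?_) hε.1 hε.2.le
      exact image_eq_zero_of_notMem_tsupport (hR _ (hnorm R θ hR0.le).ge)
    have := tendsto_nhds_unique (h1.congr' heq) h2
    rw [this]
    simp only [ofReal_zero, zero_mul, add_zero, intervalIntegral.integral_const, real_smul]
    push_cast
    ring
  have htarget : ∫ x in Set.Ioi (0 : ℝ) ×ˢ Set.Ioo (-Real.pi) Real.pi, D x.1 x.2 =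
      ∫ r in (0 : ℝ)..R, ∫ θ in (-Real.pi)..Real.pi, D r θ := by
    have hDi : IntegrableOn (fun x : ℝ × ℝ => D x.1 x.2)
        (Set.Ioc 0 R ×ˢ Set.Ioc (-Real.pi) Real.pi) := by
      refine Measure.integrableOn_of_bounded (M := 2 * M) ?_ hDm.aestronglyMeasurable
        (Filter.Eventually.of_forall fun x => hDb _ _)
      rw [Measure.volume_eq_prod, Measure.prod_prod]
      exact ENNReal.mul_ne_top (by simp) (by simp)
    rw [intervalIntegral.integral_of_le hR0.le]
    simp_rw [intervalIntegral.integral_of_le (neg_le_self Real.pi_pos.le)]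
    rw [Measure.volume_eq_prod] at hDi ⊢
    rw [← setIntegral_prod (fun x : ℝ × ℝ => D x.1 x.2) hDi]
    have hae : (Set.Ioi (0 : ℝ) ×ˢ Set.Ioo (-Real.pi) Real.pi : Set (ℝ × ℝ))
        =ᵐ[(volume : Measure ℝ).prod volume] Set.Ioi (0 : ℝ) ×ˢ Set.Ioc (-Real.pi) Real.pi :=
      Measure.set_prod_ae_eq (Filter.EventuallyEq.refl _ _) Ioo_ae_eq_Ioc
    rw [setIntegral_congr_set hae]
    refine setIntegral_eq_of_subset_of_forall_sdiff_eq_zero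
      (measurableSet_Ioi.prod measurableSet_Ioc)
      (Set.prod_mono Set.Ioc_subset_Ioi_self subset_rfl) ?_
    rintro ⟨r, θ⟩ ⟨⟨h1, h2⟩, h3⟩
    have : R ≤ r := by
      by_contra hlt
      exact h3 ⟨⟨h1, (not_le.mp hlt).le⟩, h2⟩
    simp [hD, hd0 r θ this]
  have hshift : ∫ ζ, dbar ζ * (ζ - z)⁻¹ = ∫ w, dbar (z + w) * w⁻¹ := by
    rw [← integral_add_left_eq_self _ z]
    simp
  have hfin : ∫ w, dbar (z + w) * w⁻¹ =
      ∫ x in Set.Ioi (0 : ℝ) ×ˢ Set.Ioo (-Real.pi) Real.pi, (1 / 2 : ℂ) * D x.1 x.2 := by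
    rw [← Complex.integral_comp_polarCoord_symm]
    refine setIntegral_congr_fun (measurableSet_Ioi.prod measurableSet_Ioo) ?_
    rintro ⟨r, θ⟩ ⟨h1, -⟩
    have h1 : 0 < r := h1
    have hr0 : (r : ℂ) ≠ 0 := by exact_mod_cast h1.ne'
    have e : Complex.polarCoord.symm (r, θ) = r * exp (θ * I) := by
      rw [Complex.polarCoord_symm_apply, exp_mul_I]
      simp
    simp only [e, hD, exp_neg, Complex.real_smul]
    have := exp_ne_zero (θ * I)
    field_simp
  rw [hshift, hfin, integral_const_mul, htarget, hpol]
  ring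

section Spectral

variable {K : Type*} [NormedAddCommGroup K] [InnerProductSpace ℂ K] [CompleteSpace K]

/-- The complexification `C(X, ℝ) → C(X, ℂ)`. -/
noncomputable def ContinuousMap.complexify {X : Type*} [TopologicalSpace X] (f : C(X, ℝ)) :
    C(X, ℂ) :=
  ⟨fun x => (f x : ℂ), by fun_prop⟩

lemma inner_cfcHom_complexify_nonneg (c : K →L[ℂ] K) (hc : IsStarNormal c) (x : K)
    (f : C(spectrum ℂ c, ℝ)) (hf : 0 ≤ f) :
    0 ≤ (⟪x, cfcHom hc f.complexify x⟫_ℂ).re := by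
  set s : C(spectrum ℂ c, ℝ) := ⟨fun z => Real.sqrt (f z), by fun_prop⟩
  have hs : f.complexify = star s.complexify * s.complexify := by
    ext z
    have hz : 0 ≤ f z := hf z
    simp only [ContinuousMap.complexify, ContinuousMap.coe_mk, ContinuousMap.mul_apply,
      ContinuousMap.star_apply, s, RCLike.star_def, Complex.conj_ofReal]
    rw [← Complex.ofReal_mul, Real.mul_self_sqrt hz]
  rw [hs, map_mul, map_star, ContinuousLinearMap.star_eq_adjoint, mul_apply_eq_comp,
    ContinuousLinearMap.adjoint_inner_right]
  exact inner_self_nonneg (𝕜 := ℂ)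

lemma inner_cfcHom_complexify_im (c : K →L[ℂ] K) (hc : IsStarNormal c) (x : K)
    (f : C(spectrum ℂ c, ℝ)) :
    (⟪x, cfcHom hc f.complexify x⟫_ℂ).im = 0 := by
  have hs : star f.complexify = f.complexify := by
    ext z
    simp [ContinuousMap.complexify]
  have h : ⟪x, cfcHom hc f.complexify x⟫_ℂ = ⟪cfcHom hc f.complexify x, x⟫_ℂ := by
    conv_lhs => rw [← hs, map_star, ContinuousLinearMap.star_eq_adjoint,
      ContinuousLinearMap.adjoint_inner_right]
  exact Complex.conj_eq_iff_im.mp (by rw [inner_conj_symm, ← h])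

/-- The scalar spectral measure of a normal operator at a vector. -/
lemma exists_measure_inner_cfc (c : K →L[ℂ] K) [hc : IsStarNormal c] (x : K) :
    ∃ μ : Measure (spectrum ℂ c), IsFiniteMeasure μ ∧ ∀ f : ℂ → ℂ, Continuous f →
      ⟪x, cfc f c x⟫_ℂ = ∫ z, f z ∂μ := by
  let Λ : CompactlySupportedContinuousMap (spectrum ℂ c) ℝ →ₚ[ℝ] ℝ := PositiveLinearMap.mk₀
    { toFun := fun f => (⟪x, cfcHom hc f.toContinuousMap.complexify x⟫_ℂ).re
      map_add' := fun f g => by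
        have : (f + g).toContinuousMap.complexify =
            f.toContinuousMap.complexify + g.toContinuousMap.complexify := by
          ext z; simp [ContinuousMap.complexify]
        rw [this]; simp
      map_smul' := fun r f => by
        have : (r • f).toContinuousMap.complexify =
            (r : ℂ) • f.toContinuousMap.complexify := by
          ext z; simp [ContinuousMap.complexify]
        rw [this]; simp }
    (fun f hf => inner_cfcHom_complexify_nonneg c hc x _ hf)
  have hΛ : ∀ f : C(spectrum ℂ c, ℝ), ⟪x, cfcHom hc f.complexify x⟫_ℂ =
      ((∫ z, f z ∂(RealRMK.rieszMeasure Λ) : ℝ) : ℂ) := by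
    intro f
    have h := RealRMK.integral_rieszMeasure Λ
      (CompactlySupportedContinuousMap.continuousMapEquiv f)
    refine Complex.ext ?_ ?_
    · rw [Complex.ofReal_re]; exact h.symm
    · rw [Complex.ofReal_im]; exact inner_cfcHom_complexify_im c hc x f
  have hfin : IsFiniteMeasure (RealRMK.rieszMeasure Λ) := inferInstance
  refine ⟨RealRMK.rieszMeasure Λ, hfin, fun f hf => ?_⟩
  set u : C(spectrum ℂ c, ℝ) := ⟨fun z => (f z).re, by fun_prop⟩ with hu
  set v : C(spectrum ℂ c, ℝ) := ⟨fun z => (f z).im, by fun_prop⟩ with hv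
  have hfuv : cfc f c = cfcHom hc u.complexify + Complex.I • cfcHom hc v.complexify := by
    rw [cfc_apply f c hc hf.continuousOn, ← map_smul, ← map_add]
    congr 1
    ext z
    simp [ContinuousMap.complexify, hu, hv, mul_comm Complex.I]
  have hfi : Integrable (fun z : spectrum ℂ c => f z) (RealRMK.rieszMeasure Λ) :=
    (hf.comp continuous_subtype_val).integrable_of_hasCompactSupport
      (HasCompactSupport.of_compactSpace _)
  rw [hfuv, add_apply, inner_add_right, smul_apply,
    inner_smul_right, hΛ, hΛ, ← integral_re_add_im hfi]
  simp [hu, hv, mul_comm Complex.I]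

/-- Polarized form of the spectral measure: `⟪ξ, f(c) η⟫` is a complex combination of integrals. -/
lemma exists_measures_inner_cfc (c : K →L[ℂ] K) [IsStarNormal c] (ξ η : K) :
    ∃ (w : Fin 4 → ℂ) (μ : Fin 4 → Measure (spectrum ℂ c)), (∀ i, IsFiniteMeasure (μ i)) ∧
      ∀ f : ℂ → ℂ, Continuous f → ⟪ξ, cfc f c η⟫_ℂ = ∑ i, w i * ∫ z, f z ∂μ i := by
  choose μ hμ h using exists_measure_inner_cfc c
  refine ⟨![1 / 4, -(1 / 4), Complex.I / 4, -(Complex.I / 4)],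
    ![μ (ξ + η), μ (ξ - η), μ (ξ - Complex.I • η), μ (ξ + Complex.I • η)], ?_, fun f hf => ?_⟩
  · intro i; fin_cases i <;> exact hμ _
  · simp only [Fin.sum_univ_four, Matrix.cons_val, ← h _ f hf, map_add, map_sub, map_smul,
      inner_add_left, inner_add_right, inner_sub_left, inner_sub_right, inner_smul_left,
      inner_smul_right, Complex.conj_I]
    ring_nf
    simp only [Complex.I_sq]
    ring

end Spectral

section Subnormal

variable {K : Type*} [NormedAddCommGroup K] [InnerProductSpace ℂ K] [CompleteSpace K]

/-- If `ζ ∉ σ(a)`, functions supported close to `ζ` annihilate `H`. -/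
lemma cfc_apply_eq_zero_of_support_subset {H : Submodule ℂ K} {c : K →L[ℂ] K} [IsStarNormal c]
    {a : ↥H →L[ℂ] ↥H} (hrestr : ∀ ξ : ↥H, ((a ξ : K)) = c (ξ : K)) {ζ : ℂ}
    (hζ : ζ ∉ spectrum ℂ a) {s : ℝ} (hs0 : 0 ≤ s)
    (hs : s * ‖Ring.inverse (ζ • (1 : ↥H →L[ℂ] ↥H) - a)‖ < 1) {f : ℂ → ℂ} (hf : Continuous f)
    (hf1 : ∀ z, ‖f z‖ ≤ 1) (hfs : ∀ z, f z ≠ 0 → ‖ζ - z‖ ≤ s) (x : H) :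
    cfc f c (x : K) = 0 := by
  set T := Ring.inverse (ζ • (1 : ↥H →L[ℂ] ↥H) - a) with hT
  have hu : IsUnit (ζ • (1 : ↥H →L[ℂ] ↥H) - a) := by
    rw [spectrum.notMem_iff, Algebra.algebraMap_eq_smul_one] at hζ
    exact hζ
  have hpow : ∀ n : ℕ, cfc (fun z => (ζ - z) ^ n) c ((T ^ n) x : K) = x := by
    intro n
    have hc : cfc (fun z : ℂ => (ζ - z) ^ n) c = (ζ • (1 : K →L[ℂ] K) - c) ^ n := by
      rw [cfc_pow (fun z : ℂ => ζ - z) n c, cfc_sub (fun _ : ℂ => ζ) (fun z => z) c, cfc_const ζ c,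
        cfc_id' ℂ c, Algebra.algebraMap_eq_smul_one]
    have hcomm : ∀ (m : ℕ) (y : H), ((ζ • (1 : K →L[ℂ] K) - c) ^ m) (y : K) =
        (((ζ • (1 : ↥H →L[ℂ] ↥H) - a) ^ m) y : H) := by
      intro m
      induction m with
      | zero => intro y; simp
      | succ m ih =>
        intro y
        rw [pow_succ, pow_succ, mul_apply_eq_comp, mul_apply_eq_comp, ← ih]
        simp [hrestr]
    have hmul : (ζ • (1 : ↥H →L[ℂ] ↥H) - a) ^ n * T ^ n = 1 := by
      have hc : Commute (ζ • (1 : ↥H →L[ℂ] ↥H) - a) T := by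
        rw [Commute, SemiconjBy, hT, Ring.mul_inverse_cancel _ hu, Ring.inverse_mul_cancel _ hu]
      rw [← hc.mul_pow, hT, Ring.mul_inverse_cancel _ hu, one_pow]
    rw [hc, hcomm, ← mul_apply_eq_comp, hmul]
    rfl
  have hbound : ∀ n : ℕ, ‖cfc f c (x : K)‖ ≤ (s * ‖T‖) ^ n * ‖x‖ := by
    intro n
    have h1 : cfc f c (x : K) = cfc (fun z => f z * (ζ - z) ^ n) c ((T ^ n) x : K) := by
      rw [cfc_mul f (fun z => (ζ - z) ^ n) c hf.continuousOn, mul_apply_eq_comp, hpow]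
    have h2 : ‖cfc (fun z => f z * (ζ - z) ^ n) c‖ ≤ s ^ n := by
      refine norm_cfc_le (by positivity) fun z _ => ?_
      by_cases hz : f z = 0
      · simp only [hz, zero_mul, norm_zero]; positivity
      · rw [norm_mul, norm_pow]
        calc ‖f z‖ * ‖ζ - z‖ ^ n ≤ 1 * s ^ n := by
              gcongr
              · exact hf1 z
              · exact hfs z hz
          _ = s ^ n := one_mul _
    have h3 : ‖((T ^ n) x : K)‖ ≤ ‖T‖ ^ n * ‖x‖ := by
      rw [Submodule.norm_coe]
      clear h1 h2
      induction n with
      | zero => simp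
      | succ n ih =>
        rw [pow_succ', pow_succ', mul_apply_eq_comp, mul_assoc]
        exact (T.le_opNorm _).trans (by gcongr)
    rw [h1, mul_pow, mul_assoc]
    exact ((ContinuousLinearMap.le_opNorm _ _).trans (by gcongr))
  have hlim : Filter.Tendsto (fun n : ℕ => (s * ‖T‖) ^ n * ‖x‖) Filter.atTop (nhds 0) := by
    simpa using (tendsto_pow_atTop_nhds_zero_of_lt_one (by positivity) hs).mul_const ‖x‖
  exact norm_le_zero_iff.mp (ge_of_tendsto' hlim hbound)

/-- A continuous regularization of the Cauchy kernel `z ↦ z⁻¹`. -/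
noncomputable def regInv (ε : ℝ) (z : ℂ) : ℂ :=
  starRingEnd ℂ z * ((max (‖z‖ ^ 2) (ε ^ 2) : ℝ) : ℂ)⁻¹

lemma continuous_regInv {ε : ℝ} (hε : 0 < ε) : Continuous (regInv ε) := by
  unfold regInv
  have : ∀ z : ℂ, ((max (‖z‖ ^ 2) (ε ^ 2) : ℝ) : ℂ) ≠ 0 := fun z => by
    have : 0 < max (‖z‖ ^ 2) (ε ^ 2) := lt_max_of_lt_right (by positivity)
    exact_mod_cast this.ne'
  have h2 : Continuous fun z : ℂ => ((max (‖z‖ ^ 2) (ε ^ 2) : ℝ) : ℂ) := by fun_prop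
  exact Complex.continuous_conj.mul (h2.inv₀ this)

lemma regInv_eq_inv {ε : ℝ} {z : ℂ} (hε : 0 ≤ ε) (hz : ε ≤ ‖z‖) : regInv ε z = z⁻¹ := by
  rw [regInv, max_eq_left (by gcongr), Complex.inv_def z, Complex.normSq_eq_norm_sq,
    Complex.ofReal_inv]

lemma norm_regInv_le (ε : ℝ) (z : ℂ) : ‖regInv ε z‖ ≤ ‖z‖⁻¹ := by
  rcases eq_or_ne z 0 with rfl | hz
  · simp [regInv]
  · have hz' : 0 < ‖z‖ := norm_pos_iff.mpr hz
    have h0 : 0 < max (‖z‖ ^ 2) (ε ^ 2) := lt_max_of_lt_left (by positivity)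
    rw [regInv, norm_mul, RCLike.norm_conj, norm_inv, Complex.norm_real, Real.norm_of_nonneg h0.le,
      ← div_eq_mul_inv, div_le_iff₀ h0]
    calc ‖z‖ = ‖z‖⁻¹ * ‖z‖ ^ 2 := by field_simp
      _ ≤ _ := by gcongr; exact le_max_left _ _

lemma tendsto_regInv (z : ℂ) :
    Filter.Tendsto (fun ε => regInv ε z) (nhdsWithin 0 (Set.Ioi 0)) (nhds z⁻¹) := by
  rcases eq_or_ne z 0 with rfl | hz
  · simp [regInv]
  · refine tendsto_const_nhds.congr' ?_
    filter_upwards [Ioo_mem_nhdsGT (norm_pos_iff.mpr hz)] with ε hε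
    exact (regInv_eq_inv hε.1.le hε.2.le).symm

lemma regInv_mul_self_of_le {ε : ℝ} {z : ℂ} (hε : 0 < ε) (hz : ε ≤ ‖z‖) : regInv ε z * z = 1 := by
  rw [regInv_eq_inv hε.le hz, inv_mul_cancel₀ (norm_pos_iff.mp (hε.trans_le hz))]

lemma norm_one_sub_regInv_mul_self_le {ε : ℝ} (hε : 0 < ε) (z : ℂ) :
    ‖1 - regInv ε z * z‖ ≤ 1 := by
  have h0 : 0 < max (‖z‖ ^ 2) (ε ^ 2) := lt_max_of_lt_right (by positivity)
  have : 1 - regInv ε z * z = ((1 - ‖z‖ ^ 2 / max (‖z‖ ^ 2) (ε ^ 2) : ℝ) : ℂ) := by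
    have : starRingEnd ℂ z * z = ((‖z‖ ^ 2 : ℝ) : ℂ) := by
      rw [mul_comm, Complex.mul_conj, Complex.normSq_eq_norm_sq]
    rw [regInv, mul_right_comm, this]
    push_cast
    ring
  rw [this, Complex.norm_real, Real.norm_eq_abs, abs_le]
  have h1 : ‖z‖ ^ 2 / max (‖z‖ ^ 2) (ε ^ 2) ≤ 1 := (div_le_one h0).mpr (le_max_left _ _)
  have h2 : 0 ≤ ‖z‖ ^ 2 / max (‖z‖ ^ 2) (ε ^ 2) := by positivity
  constructor <;> linarith

/-- On `H`, the resolvent of `a` is given by a regularized Cauchy kernel applied to `c`. -/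
lemma cfc_regInv_apply_eq_resolvent {H : Submodule ℂ K} {c : K →L[ℂ] K} [IsStarNormal c]
    {a : ↥H →L[ℂ] ↥H} (hrestr : ∀ ξ : ↥H, ((a ξ : K)) = c (ξ : K)) {ζ : ℂ}
    (hζ : ζ ∉ spectrum ℂ a) {ε : ℝ} (hε : 0 < ε)
    (hεT : ε * ‖Ring.inverse (ζ • (1 : ↥H →L[ℂ] ↥H) - a)‖ < 1) (η : H) :
    cfc (fun z => regInv ε (ζ - z)) c (η : K) =
      (Ring.inverse (ζ • (1 : ↥H →L[ℂ] ↥H) - a) η : H) := by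
  set T := Ring.inverse (ζ • (1 : ↥H →L[ℂ] ↥H) - a) with hT
  have hk : Continuous fun z => regInv ε (ζ - z) :=
    (continuous_regInv hε).comp (continuous_const.sub continuous_id)
  have hu : IsUnit (ζ • (1 : ↥H →L[ℂ] ↥H) - a) := by
    rw [spectrum.notMem_iff, Algebra.algebraMap_eq_smul_one] at hζ
    exact hζ
  have hη : cfc (fun z => ζ - z) c (T η : K) = η := by
    rw [cfc_sub (fun _ : ℂ => ζ) (fun z => z) c, cfc_const ζ c, cfc_id' ℂ c,
      Algebra.algebraMap_eq_smul_one]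
    have h : (ζ • (1 : ↥H →L[ℂ] ↥H) - a) (T η) = η := by
      rw [← mul_apply_eq_comp, hT, Ring.mul_inverse_cancel _ hu]; rfl
    simpa [hrestr] using congrArg (Subtype.val) h
  have hzero : cfc (fun z => 1 - regInv ε (ζ - z) * (ζ - z)) c (T η : K) = 0 := by
    refine cfc_apply_eq_zero_of_support_subset hrestr hζ hε.le hεT (by fun_prop)
      (fun z => norm_one_sub_regInv_mul_self_le hε _) (fun z hz => ?_) _
    by_contra hlt
    exact hz (by rw [regInv_mul_self_of_le hε (not_le.mp hlt).le, sub_self])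
  rw [cfc_sub (fun _ : ℂ => 1) (fun z => regInv ε (ζ - z) * (ζ - z)) c (by fun_prop) (by fun_prop),
    cfc_const_one ℂ c, cfc_mul (fun z => regInv ε (ζ - z)) (fun z => ζ - z) c hk.continuousOn,
    sub_apply, mul_apply_eq_comp, hη, one_apply_eq_self] at hzero
  exact (sub_eq_zero.mp hzero).symm

end Subnormal

section Main

lemma integrable_indicator_ball_norm_inv :
    Integrable (fun z : ℂ => (Metric.ball (0 : ℂ) 1).indicator (fun z => ‖z‖⁻¹) z) := by
  have hm : Measurable fun z : ℂ => (Metric.ball (0 : ℂ) 1).indicator (fun z => ‖z‖⁻¹) z :=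
    Measurable.indicator (by fun_prop) measurableSet_ball
  refine ⟨hm.aestronglyMeasurable, ?_⟩
  rw [HasFiniteIntegral, ← Complex.lintegral_comp_polarCoord_symm]
  have hfin : (volume : Measure (ℝ × ℝ)) (Set.Ioc (0 : ℝ) 1 ×ˢ Set.Ioc (-Real.pi) Real.pi) < ⊤ := by
    rw [Measure.volume_eq_prod, Measure.prod_prod]
    exact ENNReal.mul_lt_top (by simp) (by simp)
  refine lt_of_le_of_lt ?_ hfin
  rw [← lintegral_indicator_one (measurableSet_Ioc.prod measurableSet_Ioc),
    polarCoord_target, ← lintegral_indicator (measurableSet_Ioi.prod measurableSet_Ioo)]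
  refine lintegral_mono fun p => ?_
  refine Set.indicator_le (fun p hp => ?_) p
  have hp1 : 0 < p.1 := hp.1
  have hn : ‖Complex.polarCoord.symm p‖ = p.1 := by
    rw [Complex.norm_polarCoord_symm, abs_of_pos hp1]
  by_cases hlt : p.1 < 1
  · have hmem : p ∈ Set.Ioc (0 : ℝ) 1 ×ˢ Set.Ioc (-Real.pi) Real.pi :=
      ⟨⟨hp1, hlt.le⟩, hp.2.1, hp.2.2.le⟩
    have hb : Complex.polarCoord.symm p ∈ Metric.ball (0 : ℂ) 1 := by
      rwa [mem_ball_zero_iff, hn]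
    rw [Set.indicator_of_mem hmem, Set.indicator_of_mem hb, hn,
      Real.enorm_of_nonneg (by positivity), smul_eq_mul, ← ENNReal.ofReal_mul hp1.le, mul_inv_cancel₀ hp1.ne']
    simp
  · have hb : Complex.polarCoord.symm p ∉ Metric.ball (0 : ℂ) 1 := by
      rwa [mem_ball_zero_iff, hn]
    rw [Set.indicator_of_notMem hb]
    simp

/-- The Cauchy kernel against a bounded integrable density is integrable for the product of
Lebesgue measure and a finite measure. -/
lemma integrable_mul_inv_sub_prod {h : ℂ → ℂ} {M : ℝ} (hM : ∀ ζ, ‖h ζ‖ ≤ M) (hmeas : Measurable h)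
    (hint : Integrable h) {S : Set ℂ} (μ : Measure S) [IsFiniteMeasure μ] :
    Integrable (fun p : ℂ × S => h p.1 * (p.1 - p.2)⁻¹) (volume.prod μ) := by
  set φ : ℂ → ℝ := fun z => (Metric.ball (0 : ℂ) 1).indicator (fun z => ‖z‖⁻¹) z with hφ
  have hφi : Integrable φ := integrable_indicator_ball_norm_inv
  have hM0 : 0 ≤ M := (norm_nonneg _).trans (hM 0)
  have hφ0 : ∀ z, 0 ≤ φ z := fun z => Set.indicator_nonneg (fun _ _ => by positivity) z
  have hle : ∀ ζ z : ℂ, ‖h ζ * (ζ - z)⁻¹‖ ≤ M * φ (ζ - z) + ‖h ζ‖ := by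
    intro ζ z
    rw [norm_mul, norm_inv]
    by_cases hb : ζ - z ∈ Metric.ball (0 : ℂ) 1
    · rw [hφ]
      simp only [Set.indicator_of_mem hb]
      have : ‖h ζ‖ * ‖ζ - z‖⁻¹ ≤ M * ‖ζ - z‖⁻¹ := by gcongr; exact hM ζ
      linarith [norm_nonneg (h ζ)]
    · have h1 : ‖ζ - z‖⁻¹ ≤ 1 := by
        rw [mem_ball_zero_iff, not_lt] at hb
        exact inv_le_one_of_one_le₀ hb
      have h2 : ‖h ζ‖ * ‖ζ - z‖⁻¹ ≤ ‖h ζ‖ * 1 := by gcongr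
      have := mul_nonneg hM0 (hφ0 (ζ - z))
      linarith
  have hdom : ∀ z : ℂ, Integrable fun ζ => M * φ (ζ - z) + ‖h ζ‖ := fun z =>
    ((hφi.comp_sub_right z).const_mul M).add hint.norm
  have hm : Measurable fun p : ℂ × S => h p.1 * (p.1 - p.2)⁻¹ := by fun_prop
  rw [integrable_prod_iff' hm.aestronglyMeasurable]
  have hsec : ∀ z : S, Integrable fun ζ => h ζ * (ζ - z)⁻¹ := fun z =>
    (hdom z).mono' (by fun_prop) (Filter.Eventually.of_forall fun ζ => hle ζ z)
  refine ⟨Filter.Eventually.of_forall hsec, ?_⟩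
  refine Integrable.of_bound (C := M * (∫ z, φ z) + ∫ ζ, ‖h ζ‖)
    (hm.norm.stronglyMeasurable.integral_prod_left').aestronglyMeasurable
    (Filter.Eventually.of_forall fun z => ?_)
  rw [Real.norm_of_nonneg (integral_nonneg fun _ => norm_nonneg _)]
  calc ∫ ζ, ‖h ζ * (ζ - (z : ℂ))⁻¹‖ ≤ ∫ ζ, (M * φ (ζ - z) + ‖h ζ‖) :=
        integral_mono (hsec z).norm (hdom z) fun ζ => hle ζ z
    _ = _ := by
      rw [integral_add ((hφi.comp_sub_right _).const_mul M) hint.norm, integral_const_mul,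
        integral_sub_right_eq_self φ]

/-- Off `σ(a)`, the resolvent matrix coefficients are the Cauchy transforms of the spectral
measures, wherever these converge absolutely. -/
lemma sum_integral_inv_sub_eq_inner_resolvent {K : Type*} [NormedAddCommGroup K]
    [InnerProductSpace ℂ K] [CompleteSpace K] {H : Submodule ℂ K} {c : K →L[ℂ] K}
    [IsStarNormal c] {a : ↥H →L[ℂ] ↥H} (hrestr : ∀ ξ : ↥H, ((a ξ : K)) = c (ξ : K))
    {ξ : K} {η : H} {ι : Type*} [Fintype ι] {w : ι → ℂ} {μ : ι → Measure (spectrum ℂ c)}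
    (hinner : ∀ f : ℂ → ℂ, Continuous f → ⟪ξ, cfc f c (η : K)⟫_ℂ = ∑ i, w i * ∫ z, f z ∂μ i)
    {ζ : ℂ} (hζ : ζ ∉ spectrum ℂ a) (t : ℂ)
    (hζi : ∀ i, Integrable (fun z : spectrum ℂ c => t * (ζ - (z : ℂ))⁻¹) (μ i)) :
    ∑ i, w i * ∫ z, t * (ζ - (z : ℂ))⁻¹ ∂μ i =
      t * ⟪ξ, ((Ring.inverse (ζ • (1 : ↥H →L[ℂ] ↥H) - a) η : ↥H) : K)⟫_ℂ := by
  set T := Ring.inverse (ζ • (1 : ↥H →L[ℂ] ↥H) - a) with hT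
  have hlim : Filter.Tendsto
      (fun ε : ℝ => ∑ i, w i * ∫ z : spectrum ℂ c, t * regInv ε (ζ - z) ∂μ i)
      (nhdsWithin 0 (Set.Ioi 0)) (nhds (∑ i, w i * ∫ z, t * (ζ - (z : ℂ))⁻¹ ∂μ i)) := by
    refine tendsto_finsetSum _ fun i _ => Filter.Tendsto.const_mul _ ?_
    refine tendsto_integral_filter_of_dominated_convergence
      (fun z : spectrum ℂ c => ‖t * (ζ - (z : ℂ))⁻¹‖) ?_ ?_ (hζi i).norm ?_
    · filter_upwards [self_mem_nhdsWithin] with ε hε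
      have := continuous_regInv hε
      exact (by fun_prop : Continuous fun z : spectrum ℂ c =>
        t * regInv ε (ζ - z)).aestronglyMeasurable
    · refine Filter.Eventually.of_forall fun ε => Filter.Eventually.of_forall fun z => ?_
      rw [norm_mul, norm_mul, norm_inv]
      gcongr
      exact norm_regInv_le _ _
    · exact Filter.Eventually.of_forall fun z => (tendsto_regInv _).const_mul _
  refine tendsto_nhds_unique hlim (tendsto_const_nhds.congr' ?_)
  have hsmall : ∀ᶠ ε : ℝ in nhdsWithin 0 (Set.Ioi 0), ε * ‖T‖ < 1 := by
    have h0 : Filter.Tendsto (fun ε : ℝ => ε * ‖T‖) (nhdsWithin 0 (Set.Ioi 0)) (nhds 0) := by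
      have : Continuous fun ε : ℝ => ε * ‖T‖ := by fun_prop
      simpa using (this.tendsto 0).mono_left nhdsWithin_le_nhds
    exact h0.eventually (gt_mem_nhds one_pos)
  filter_upwards [self_mem_nhdsWithin, hsmall] with ε hε hεT
  have hk : Continuous fun z => regInv ε (ζ - z) :=
    (continuous_regInv hε).comp (continuous_const.sub continuous_id)
  rw [← cfc_regInv_apply_eq_resolvent hrestr hζ hε hεT η, hinner _ hk, Finset.mul_sum]
  refine Finset.sum_congr rfl fun i _ => ?_
  rw [integral_const_mul]
  ring

/-- The Cauchy–Green formula for `⟪ξ, g(c) η⟫` with `η ∈ H` and `ξ` arbitrary. -/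
lemma inner_cfc_eq_integral_resolvent {K : Type*} [NormedAddCommGroup K] [InnerProductSpace ℂ K]
    [CompleteSpace K] {H : Submodule ℂ K} (hHc : IsClosed (H : Set K)) {c : K →L[ℂ] K}
    [IsStarNormal c] {a : ↥H →L[ℂ] ↥H} (hrestr : ∀ ξ : ↥H, ((a ξ : K)) = c (ξ : K))
    {g : ℂ → ℂ} (hg : Differentiable ℝ g) (hgc : HasCompactSupport g) {dbar : ℂ → ℂ}
    (hdbar : ∀ ζ : ℂ, dbar ζ
      = (1 / 2) * (fderiv ℝ g ζ 1 + Complex.I * fderiv ℝ g ζ Complex.I))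
    (hbdd : ∃ M : ℝ, ∀ ζ : ℂ, ‖dbar ζ‖ ≤ M) (hvan : ∀ ζ ∈ spectrum ℂ a, dbar ζ = 0)
    (ξ : K) (η : H) :
    IntegrableOn (fun ζ : ℂ => dbar ζ *
        (⟪ξ, ((Ring.inverse (ζ • (1 : ↥H →L[ℂ] ↥H) - a) η : ↥H) : K)⟫_ℂ)) (spectrum ℂ a)ᶜ ∧
      ⟪ξ, cfc g c (η : K)⟫_ℂ = -(1 / (Real.pi : ℂ)) * ∫ ζ in (spectrum ℂ a)ᶜ,
        dbar ζ * (⟪ξ, ((Ring.inverse (ζ • (1 : ↥H →L[ℂ] ↥H) - a) η : ↥H) : K)⟫_ℂ) := by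
  obtain ⟨M, hM⟩ := hbdd
  have : CompleteSpace H := hHc.completeSpace_coe
  have hσ : MeasurableSet (spectrum ℂ a)ᶜ := (spectrum.isClosed (𝕜 := ℂ) a).measurableSet.compl
  have hmeas : Measurable dbar := by
    rw [funext hdbar]
    exact ((measurable_fderiv_apply_const ℝ g 1).add
      ((measurable_fderiv_apply_const ℝ g Complex.I).const_mul _)).const_mul _
  have hint : Integrable dbar := by
    rw [← integrableOn_iff_integrable_of_support_subset (s := tsupport g)
      (Function.support_subset_iff'.mpr fun ζ hζ => dbar_eq_zero_of_notMem_tsupport hdbar hζ)]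
    exact Measure.integrableOn_of_bounded hgc.measure_lt_top.ne hmeas.aestronglyMeasurable
      (Filter.Eventually.of_forall hM)
  obtain ⟨w, μ, hμ, hinner⟩ := exists_measures_inner_cfc c ξ (η : K)
  have hprod : ∀ i, Integrable (fun p : ℂ × spectrum ℂ c => dbar p.1 * (p.1 - p.2)⁻¹)
      (volume.prod (μ i)) := fun i => integrable_mul_inv_sub_prod hM hmeas hint (μ i)
  set F : Fin 4 → ℂ → ℂ := fun i ζ => ∫ z, dbar ζ * (ζ - (z : ℂ))⁻¹ ∂μ i with hF
  have hFi : ∀ i, Integrable (F i) := fun i => (hprod i).integral_prod_left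
  set G : ℂ → ℂ := fun ζ => ∑ i, w i * F i ζ with hG
  have hGi : Integrable G := integrable_finsetSum _ fun i _ => (hFi i).const_mul _
  have hae : ∀ᵐ ζ : ℂ, ζ ∈ (spectrum ℂ a)ᶜ → G ζ = dbar ζ *
      (⟪ξ, ((Ring.inverse (ζ • (1 : ↥H →L[ℂ] ↥H) - a) η : ↥H) : K)⟫_ℂ) := by
    have hall : ∀ᵐ ζ : ℂ, ∀ i,
        Integrable (fun z : spectrum ℂ c => dbar ζ * (ζ - (z : ℂ))⁻¹) (μ i) :=
      ae_all_iff.mpr fun i => (hprod i).prod_right_ae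
    filter_upwards [hall] with ζ hζi hζ
    exact sum_integral_inv_sub_eq_inner_resolvent hrestr hinner hζ _ hζi
  have haer := (ae_restrict_iff' hσ).mpr hae
  have hGint : ∫ ζ, G ζ = -(Real.pi : ℂ) * ⟪ξ, cfc g c (η : K)⟫_ℂ := by
    rw [hinner g hg.continuous, hG, integral_finsetSum _ fun i _ => (hFi i).const_mul _,
      Finset.mul_sum]
    refine Finset.sum_congr rfl fun i _ => ?_
    rw [integral_const_mul, hF]
    simp only
    rw [integral_integral_swap (hprod i)]
    simp_rw [integral_dbar_mul_inv_sub hg hgc hdbar hM hmeas]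
    rw [integral_const_mul]
    ring
  refine ⟨hGi.integrableOn.congr haer, ?_⟩
  rw [← integral_congr_ae haer, setIntegral_eq_integral_of_forall_compl_eq_zero, hGint]
  · have : (Real.pi : ℂ) ≠ 0 := by exact_mod_cast Real.pi_ne_zero
    field_simp
  · intro ζ hζ
    simp [hG, hF, hvan ζ (by simpa using hζ)]

end Main

/-- Cauchy–Green formula for a subnormal operator `a` (the restriction of a
normal operator `c` to the invariant closed subspace `H`): if `g` is a
compactly supported differentiable function with `∂̄g` bounded and vanishing
on `σ(a)`, then `H` is invariant for `g(c)`, the integral is absolutely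
convergent, and
`⟨g(a)η, ξ⟩ = −(1/π) ∫_{ℂ∖σ(a)} ∂̄g(ζ) ⟨(ζ·1 − a)⁻¹η, ξ⟩ dm(ζ)`. -/
theorem stmt_19 {K : Type*} [NormedAddCommGroup K] [InnerProductSpace ℂ K]
    [CompleteSpace K]
    (H : Submodule ℂ K) (hHc : IsClosed (H : Set K))
    (c : K →L[ℂ] K) [IsStarNormal c]
    (hinv : ∀ ξ ∈ H, c ξ ∈ H)
    (a : ↥H →L[ℂ] ↥H) (hrestr : ∀ ξ : ↥H, ((a ξ : K)) = c (ξ : K))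
    (g : ℂ → ℂ) (hg : Differentiable ℝ g) (hgc : HasCompactSupport g)
    (dbar : ℂ → ℂ)
    (hdbar : ∀ ζ : ℂ, dbar ζ
      = (1 / 2) * (fderiv ℝ g ζ 1 + Complex.I * fderiv ℝ g ζ Complex.I))
    (hbdd : ∃ M : ℝ, ∀ ζ : ℂ, ‖dbar ζ‖ ≤ M)
    (hvan : ∀ ζ ∈ spectrum ℂ a, dbar ζ = 0) :
    (∀ η : ↥H, cfc g c (η : K) ∈ H) ∧
    ∀ ξ η : ↥H,
      MeasureTheory.IntegrableOn
        (fun ζ : ℂ => dbar ζ *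
          (⟪(ξ : K), ((Ring.inverse (ζ • (1 : ↥H →L[ℂ] ↥H) - a) η : ↥H) : K)⟫_ℂ))
        (spectrum ℂ a)ᶜ ∧
      (⟪(ξ : K), cfc g c (η : K)⟫_ℂ)
        = -(1 / (Real.pi : ℂ)) * ∫ ζ in (spectrum ℂ a)ᶜ,
            dbar ζ *
              (⟪(ξ : K), ((Ring.inverse (ζ • (1 : ↥H →L[ℂ] ↥H) - a) η : ↥H) : K)⟫_ℂ) := by
  refine ⟨fun η => ?_, fun ξ η =>
    inner_cfc_eq_integral_resolvent hHc hrestr hg hgc hdbar hbdd hvan (ξ : K) η⟩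
  have : CompleteSpace H := hHc.completeSpace_coe
  have hmem : cfc g c (η : K) ∈ Hᗮᗮ → cfc g c (η : K) ∈ H := fun h => by
    rwa [Submodule.orthogonal_orthogonal] at h
  refine hmem ((Submodule.mem_orthogonal _ _).mpr fun ξ hξ => ?_)
  rw [(inner_cfc_eq_integral_resolvent hHc hrestr hg hgc hdbar hbdd hvan ξ η).2]
  have h0 : ∀ y : H, ⟪ξ, (y : K)⟫_ℂ = 0 := fun y =>
    Submodule.inner_left_of_mem_orthogonal y.2 hξ
  simp [h0]
end
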